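/- arXiv:0710.4224 — 5 statements merged into one kernel-verified Lean document; each statement's English description precedes it below -/
import Mathlib

section
/- Let F be a field, 0 ≤ m ≤ r, let G₁, G₂ ∈ GL_r(F), and let U₁, U₂ be invertible symmetric m×m matrices over F. If ᵗG₁ · diag(U₁, 0_{r−m}) · G₁ = ᵗG₂ · diag(U₂, 0_{r−m}) · G₂, then the span of the first m rows of G₁ equals the span of the first m rows of G₂; moreover G₂G₁⁻¹ has block form with an invertible m×m upper-left block C, zero m×(r−m) upper-right block, and U₁ = ᵗC U₂ C. In particular, if G₁ = G₂ then U₁ = U₂. -/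
open Matrix

/-- `diag(U, 0_{r-m})`: the `r × r` matrix whose upper-left `m × m` block is `U` and whose
remaining entries are `0`. -/
def Matrix.diagPad {F : Type*} [Zero F] {m r : ℕ} (U : Matrix (Fin m) (Fin m) F) :
    Matrix (Fin r) (Fin r) F :=
  Matrix.of fun i j =>
    if h : i.val < m ∧ j.val < m then U ⟨i.val, h.1⟩ ⟨j.val, h.2⟩ else 0

namespace Matrix

lemma diagPad_eq_submatrix_mul {R : Type*} [Semiring R] {m r : ℕ} (hm : m ≤ r)
    (U : Matrix (Fin m) (Fin m) R) :
    (diagPad U : Matrix (Fin r) (Fin r) R) =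
      ((1 : Matrix (Fin r) (Fin r) R).submatrix (Fin.castLE hm) id)ᵀ * U *
        (1 : Matrix (Fin r) (Fin r) R).submatrix (Fin.castLE hm) id := by
  have outside (i : Fin r) (hi : ¬ i.val < m) (k : Fin m) : Fin.castLE hm k ≠ i := by
    rintro rfl
    exact hi k.isLt
  ext i j
  by_cases hi : i.val < m
  · obtain ⟨i, rfl⟩ : ∃ k : Fin m, Fin.castLE hm k = i := ⟨⟨i, hi⟩, rfl⟩
    by_cases hj : j.val < m
    · obtain ⟨j, rfl⟩ : ∃ k : Fin m, Fin.castLE hm k = j := ⟨⟨j, hj⟩, rfl⟩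
      simp [diagPad, mul_apply, one_apply]
    · simp [diagPad, mul_apply, one_apply, hj, outside j hj]
  · simp [diagPad, mul_apply, one_apply, hi, fun k => (outside i hi k).symm]

lemma transpose_mul_diagPad_mul {R : Type*} [CommSemiring R] {m r : ℕ} (hm : m ≤ r)
    (G : Matrix (Fin r) (Fin r) R) (U : Matrix (Fin m) (Fin m) R) :
    Gᵀ * diagPad U * G =
      (G.submatrix (Fin.castLE hm) id)ᵀ * U * G.submatrix (Fin.castLE hm) id := by
  have hG : G.submatrix (Fin.castLE hm) id =
      (1 : Matrix (Fin r) (Fin r) R).submatrix (Fin.castLE hm) id * G := by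
    ext i j
    simp [mul_apply, one_apply]
  rw [diagPad_eq_submatrix_mul hm, hG, transpose_mul]
  simp only [Matrix.mul_assoc]

lemma submatrix_mul_inv_submatrix {R l n : Type*} [CommRing R] [Fintype n] [DecidableEq n]
    [DecidableEq l] {G : Matrix n n R} (hG : IsUnit G) {f : l → n} (hf : Function.Injective f) :
    G.submatrix f id * G⁻¹.submatrix id f = 1 := by
  have hmul : G.submatrix f id * G⁻¹.submatrix id f = (G * G⁻¹).submatrix f f := rfl
  rw [hmul, mul_nonsing_inv _ ((isUnit_iff_isUnit_det G).mp hG), submatrix_one f hf]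

/-- Congruent forms pulled back along two surjections differ by a left factor. -/
lemma exists_eq_mul_of_transpose_mul_mul_eq {R m n : Type*} [CommRing R] [Fintype m]
    [Fintype n] [DecidableEq m] {A₁ A₂ : Matrix m n R} {B₂ : Matrix n m R}
    (hB₂ : A₂ * B₂ = 1) {U₁ U₂ : Matrix m m R} (hU₂ : IsUnit U₂)
    (h : A₁ᵀ * U₁ * A₁ = A₂ᵀ * U₂ * A₂) : ∃ C : Matrix m m R, A₂ = C * A₁ := by
  have ht : B₂ᵀ * A₂ᵀ = 1 := by rw [← transpose_mul, hB₂, transpose_one]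
  refine ⟨U₂⁻¹ * (B₂ᵀ * (A₁ᵀ * U₁)), ?_⟩
  rw [Matrix.mul_assoc, Matrix.mul_assoc, h, Matrix.mul_assoc, ← Matrix.mul_assoc B₂ᵀ, ht,
    Matrix.one_mul, ← Matrix.mul_assoc,
    nonsing_inv_mul _ ((isUnit_iff_isUnit_det U₂).mp hU₂), Matrix.one_mul]

lemma eq_of_transpose_mul_mul_eq {R m n : Type*} [CommRing R] [Fintype m]
    [Fintype n] [DecidableEq m] {A : Matrix m n R} {B : Matrix n m R}
    (hB : A * B = 1) {U V : Matrix m m R} (h : Aᵀ * U * A = Aᵀ * V * A) : U = V := by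
  have ht : Bᵀ * Aᵀ = 1 := by rw [← transpose_mul, hB, transpose_one]
  have key (W : Matrix m m R) : Bᵀ * (Aᵀ * W * A) * B = W := by
    rw [Matrix.mul_assoc, Matrix.mul_assoc (Aᵀ * W), hB, Matrix.mul_one, ← Matrix.mul_assoc, ht,
      Matrix.one_mul]
  rw [← key U, h, key V]

lemma span_range_row_mul_le {R l m n : Type*} [Semiring R] [Fintype m]
    (C : Matrix l m R) (A : Matrix m n R) :
    Submodule.span R (Set.range (C * A).row) ≤ Submodule.span R (Set.range A.row) := by
  rw [Submodule.span_le]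
  rintro _ ⟨i, rfl⟩
  have hrow : (C * A).row i = ∑ k, C i k • A.row k := by
    ext j
    simp [mul_apply, row]
  rw [hrow]
  exact Submodule.sum_mem _ fun k _ =>
    Submodule.smul_mem _ _ (Submodule.subset_span ⟨k, rfl⟩)

end Matrix

/-- Let `F` be a field, `0 ≤ m ≤ r`, `G₁, G₂ ∈ GL_r(F)`, and `U₁, U₂` invertible symmetric
`m × m` matrices over `F`.  If `ᵗG₁ ⬝ diag(U₁,0) ⬝ G₁ = ᵗG₂ ⬝ diag(U₂,0) ⬝ G₂`, then the span of
the first `m` rows of `G₁` equals the span of the first `m` rows of `G₂`; moreover `G₂ G₁⁻¹` has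
block form with invertible `m × m` upper-left block `C`, zero `m × (r-m)` upper-right block, and
`U₁ = ᵗC U₂ C`.  In particular, if `G₁ = G₂` then `U₁ = U₂`. -/
theorem conj_diagPad_eq_imp
    {F : Type*} [Field F] {r m : ℕ} (hm : m ≤ r)
    (G₁ G₂ : Matrix (Fin r) (Fin r) F) (hG₁ : IsUnit G₁) (hG₂ : IsUnit G₂)
    (U₁ U₂ : Matrix (Fin m) (Fin m) F)
    (hU₁s : U₁.IsSymm) (hU₂s : U₂.IsSymm) (hU₁ : IsUnit U₁) (hU₂ : IsUnit U₂)
    (h : G₁ᵀ * Matrix.diagPad U₁ * G₁ = G₂ᵀ * Matrix.diagPad U₂ * G₂) :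
    (Submodule.span F (Set.range fun i : Fin m => G₁ (Fin.castLE hm i))
        = Submodule.span F (Set.range fun i : Fin m => G₂ (Fin.castLE hm i))) ∧
    (∃ C : Matrix (Fin m) (Fin m) F, IsUnit C ∧
      (∀ i j : Fin m, (G₂ * G₁⁻¹) (Fin.castLE hm i) (Fin.castLE hm j) = C i j) ∧
      (∀ (i : Fin m) (j : Fin r), m ≤ j.val → (G₂ * G₁⁻¹) (Fin.castLE hm i) j = 0) ∧
      U₁ = Cᵀ * U₂ * C) ∧
    (G₁ = G₂ → U₁ = U₂) := by
  rw [transpose_mul_diagPad_mul hm, transpose_mul_diagPad_mul hm] at h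
  have hinj : Function.Injective (Fin.castLE hm) := Fin.castLE_injective hm
  have hB₁ := submatrix_mul_inv_submatrix hG₁ hinj
  have hB₂ := submatrix_mul_inv_submatrix hG₂ hinj
  obtain ⟨C, hC⟩ := exists_eq_mul_of_transpose_mul_mul_eq hB₂ hU₂ h
  obtain ⟨D, hD⟩ := exists_eq_mul_of_transpose_mul_mul_eq hB₁ hU₁ h.symm
  have hDC : D * C = 1 := by
    rw [← hB₁]
    nth_rw 1 [hD]
    rw [hC, Matrix.mul_assoc, Matrix.mul_assoc, hB₁, Matrix.mul_one]
  have hblock (i : Fin m) (j : Fin r) : (G₂ * G₁⁻¹) (Fin.castLE hm i) j =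
      (C * (1 : Matrix (Fin r) (Fin r) F).submatrix (Fin.castLE hm) id) i j := by
    have hmul (G : Matrix (Fin r) (Fin r) F) : G.submatrix (Fin.castLE hm) id * G₁⁻¹ =
        (G * G₁⁻¹).submatrix (Fin.castLE hm) id := rfl
    rw [← mul_nonsing_inv _ ((isUnit_iff_isUnit_det G₁).mp hG₁), ← hmul, ← Matrix.mul_assoc,
      ← hC]
    rfl
  refine ⟨le_antisymm ?_ ?_, ⟨C, ?_, fun i j => ?_, fun i j hj => ?_, ?_⟩, ?_⟩
  · change Submodule.span F (Set.range (G₁.submatrix (Fin.castLE hm) id).row) ≤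
      Submodule.span F (Set.range (G₂.submatrix (Fin.castLE hm) id).row)
    rw [hD]
    exact span_range_row_mul_le _ _
  · change Submodule.span F (Set.range (G₂.submatrix (Fin.castLE hm) id).row) ≤
      Submodule.span F (Set.range (G₁.submatrix (Fin.castLE hm) id).row)
    rw [hC]
    exact span_range_row_mul_le _ _
  · exact IsUnit.of_mul_eq_one_right D hDC
  · rw [hblock]
    simp [mul_apply, one_apply]
  · have hne (k : Fin m) : Fin.castLE hm k ≠ j := by
      rintro rfl
      exact absurd k.isLt (not_lt.mpr hj)
    rw [hblock]
    simp [mul_apply, one_apply, hne]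
  · refine eq_of_transpose_mul_mul_eq hB₁ ?_
    rw [h, hC, transpose_mul]
    simp only [Matrix.mul_assoc]
  · rintro rfl
    exact eq_of_transpose_mul_mul_eq hB₁ h
end

section
/- Let F_q be a finite field with q elements and let 0 ≤ m ≤ r. Then the number of symmetric r×r matrices over F_q of rank m equals the product of the number of m-dimensional subspaces of F_q^r (the Gaussian binomial coefficient [r choose m]_q) and the number of invertible symmetric m×m matrices over F_q. -/
open Matrix

/-- A subspace of dimension `m` is the range of a matrix with `m` columns and a left inverse. -/
theorem Submodule.exists_matrix_leftInverse_range_eq {F : Type*} [Field F] {r m : ℕ}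
    (Δ : Submodule F (Fin r → F)) (h : Module.finrank F Δ = m) :
    ∃ (B : Matrix (Fin r) (Fin m) F) (C : Matrix (Fin m) (Fin r) F),
      C * B = 1 ∧ LinearMap.range B.mulVecLin = Δ := by
  let e := (Module.finBasisOfFinrankEq F Δ h).equivFun.symm
  let f : (Fin m → F) →ₗ[F] (Fin r → F) := Δ.subtype ∘ₗ e.toLinearMap
  have hf : LinearMap.ker f = ⊥ :=
    LinearMap.ker_eq_bot.2 (Δ.injective_subtype.comp e.injective)
  obtain ⟨g, hg⟩ := f.exists_leftInverse_of_injective hf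
  refine ⟨LinearMap.toMatrix' f, LinearMap.toMatrix' g, ?_, ?_⟩
  · rw [← LinearMap.toMatrix'_comp, hg, LinearMap.toMatrix'_id]
  · rw [← Matrix.toLin'_apply', Matrix.toLin'_toMatrix',
      LinearMap.range_comp_of_range_eq_top _ e.range, Submodule.range_subtype]

/-- If `B` has left inverse `C`, then `U ↦ B * U * Bᵀ` identifies the invertible symmetric
matrices with the symmetric matrices whose range is that of `B`. -/
def Matrix.symmIsUnitEquivSymmRange {F : Type*} [Field F] {r m : ℕ}
    (B : Matrix (Fin r) (Fin m) F) (C : Matrix (Fin m) (Fin r) F) (hCB : C * B = 1) :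
    {W : Matrix (Fin r) (Fin r) F //
        W.IsSymm ∧ LinearMap.range W.mulVecLin = LinearMap.range B.mulVecLin} ≃
      {U : Matrix (Fin m) (Fin m) F // U.IsSymm ∧ IsUnit U} :=
  have hBC : Bᵀ * Cᵀ = 1 := by rw [← transpose_mul, hCB, transpose_one]
  have recover (W : Matrix (Fin r) (Fin r) F) (hs : W.IsSymm)
      (hW : LinearMap.range W.mulVecLin = LinearMap.range B.mulVecLin) :
      B * (C * W * Cᵀ) * Bᵀ = W := by
    have h₁ : B * C * W = W := by
      refine Matrix.toLin'.injective (LinearMap.ext fun v => ?_)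
      obtain ⟨x, hx⟩ : W.mulVecLin v ∈ LinearMap.range B.mulVecLin := hW ▸ ⟨v, rfl⟩
      simp only [mulVecLin_apply] at hx
      simp only [toLin'_apply]
      rw [← mulVec_mulVec, ← hx, mulVec_mulVec, Matrix.mul_assoc, hCB, Matrix.mul_one]
    have h₂ : W * Cᵀ * Bᵀ = W := by
      simpa [transpose_mul, hs.eq, Matrix.mul_assoc] using congrArg transpose h₁
    calc B * (C * W * Cᵀ) * Bᵀ = (B * C * W) * Cᵀ * Bᵀ := by simp only [Matrix.mul_assoc]
      _ = W := by rw [h₁, h₂]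
  { toFun W := ⟨C * W.1 * Cᵀ, by
        rw [IsSymm, transpose_mul, transpose_mul, transpose_transpose, W.2.1.eq,
          Matrix.mul_assoc], by
        have hB : m ≤ B.rank := by
          simpa [hCB] using rank_mul_le_right C B
        have hW : W.1.rank = B.rank :=
          congrArg (fun S : Submodule F (Fin r → F) => Module.finrank F S) W.2.2
        have h : W.1.rank ≤ (C * W.1 * Cᵀ).rank := by
          conv_lhs => rw [← recover W.1 W.2.1 W.2.2]
          exact (rank_mul_le_left _ _).trans (rank_mul_le_right _ _)
        have hm : (C * W.1 * Cᵀ).rank = m :=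
          le_antisymm (by simpa using rank_le_card_width (C * W.1 * Cᵀ)) (by lia)
        rw [← mulVec_surjective_iff_isUnit]
        refine LinearMap.range_eq_top (f := (C * W.1 * Cᵀ).mulVecLin).1 ?_
        exact Submodule.eq_top_of_finrank_eq (by simpa [Matrix.rank] using hm)⟩
    invFun U := ⟨B * U.1 * Bᵀ, by
        rw [IsSymm, transpose_mul, transpose_mul, transpose_transpose, U.2.1.eq,
          Matrix.mul_assoc], by
        have hU : LinearMap.range (U.1 * Bᵀ).mulVecLin = ⊤ := by
          refine LinearMap.range_eq_top.2 fun y => ?_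
          obtain ⟨z, hz⟩ := mulVec_surjective_iff_isUnit.2 U.2.2 y
          refine ⟨Cᵀ *ᵥ z, ?_⟩
          rw [mulVecLin_apply, mulVec_mulVec, Matrix.mul_assoc, hBC, Matrix.mul_one, hz]
        rw [Matrix.mul_assoc, mulVecLin_mul, LinearMap.range_comp_of_range_eq_top _ hU]⟩
    left_inv W := Subtype.ext (recover W.1 W.2.1 W.2.2)
    right_inv U := Subtype.ext <| by
      calc C * (B * U.1 * Bᵀ) * Cᵀ = (C * B) * U.1 * (Bᵀ * Cᵀ) := by
            simp only [Matrix.mul_assoc]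
        _ = U.1 := by rw [hCB, hBC, Matrix.one_mul, Matrix.mul_one] }

/-- Symmetric matrices of rank `m`, sorted by their range. -/
def Matrix.symmRankEquivSigmaRange (F : Type*) [Field F] (r m : ℕ) :
    {W : Matrix (Fin r) (Fin r) F // W.IsSymm ∧ W.rank = m} ≃
      Σ Δ : {Δ : Submodule F (Fin r → F) // Module.finrank F Δ = m},
        {W : Matrix (Fin r) (Fin r) F // W.IsSymm ∧ LinearMap.range W.mulVecLin = Δ.1} where
  toFun W := ⟨⟨LinearMap.range W.1.mulVecLin, W.2.2⟩, W.1, W.2.1, rfl⟩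
  invFun p := ⟨p.2.1, p.2.2.1, by rw [Matrix.rank, p.2.2.2, p.1.2]⟩
  left_inv _ := rfl
  right_inv := by
    rintro ⟨⟨Δ, hΔ⟩, W, hs, hW⟩
    dsimp only at hW
    subst hW
    rfl

/-- Let `F_q` be a finite field and `0 ≤ m ≤ r`.  Then the number of symmetric `r × r` matrices
over `F_q` of rank `m` equals the product of the number of `m`-dimensional subspaces of `F_q^r`
(the Gaussian binomial coefficient `[r choose m]_q`) and the number of invertible symmetric
`m × m` matrices over `F_q`. -/
theorem card_symm_rank_eq_card_subspaces_mul_card_invertible_symm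
    {F : Type*} [Field F] [Fintype F] {r m : ℕ} (hm : m ≤ r) :
    Nat.card {W : Matrix (Fin r) (Fin r) F // W.IsSymm ∧ W.rank = m}
      = Nat.card {Δ : Submodule F (Fin r → F) // Module.finrank F ↥Δ = m}
        * Nat.card {U : Matrix (Fin m) (Fin m) F // U.IsSymm ∧ IsUnit U} := by
  have key (Δ : {Δ : Submodule F (Fin r → F) // Module.finrank F Δ = m}) :
      Nonempty ({W : Matrix (Fin r) (Fin r) F //
        W.IsSymm ∧ LinearMap.range W.mulVecLin = Δ.1} ≃
          {U : Matrix (Fin m) (Fin m) F // U.IsSymm ∧ IsUnit U}) := by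
    obtain ⟨B, C, hCB, hB⟩ := Δ.1.exists_matrix_leftInverse_range_eq Δ.2
    exact hB ▸ ⟨symmIsUnitEquivSymmRange B C hCB⟩
  rw [← Nat.card_prod]
  exact Nat.card_congr ((symmRankEquivSigmaRange F r m).trans
    ((Equiv.sigmaCongrRight fun Δ => (key Δ).some).trans (Equiv.sigmaEquivProd _ _)))
end

section
/- Let F_q be a finite field, ψ : (F_q, +) → ℂˣ an additive character, T a symmetric r×r matrix over F_q, and for every 0 ≤ m ≤ r and every m-dimensional subspace Δ of F_q^r fix G_Δ ∈ GL_r(F_q) whose first m rows span Δ, and set T_Δ equal to the upper-left m×m block of G_Δ · T · ᵗG_Δ. Then Σ_{W} ψ(tr(T·W)), with W running over all symmetric r×r matrices over F_q, equals Σ_{m=0}^{r} Σ_{Δ} Σ_{U} ψ(tr(T_Δ·U)), where Δ runs over all m-dimensional subspaces of F_q^r and U runs over all invertible symmetric m×m matrices over F_q. -/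
open Matrix

/-- The upper-left `m × m` block of `G ⬝ T ⬝ ᵗG`. -/
def upperLeftBlock {F : Type*} [Field F] {r : ℕ}
    (T G : Matrix (Fin r) (Fin r) F) {m : ℕ} (h : m ≤ r) :
    Matrix (Fin m) (Fin m) F :=
  (G * T * Gᵀ).submatrix (Fin.castLE h) (Fin.castLE h)

namespace Matrix

variable {F : Type*} [Field F] {m n : Type*} [Fintype m] [Fintype n] [DecidableEq m]

/-- If `P` has right inverse `Q`, then `U` is recovered from `ᵗP ⬝ U ⬝ P`. -/
theorem transpose_mul_mul_transpose_mul_mul_cancel {P : Matrix m n F} {Q : Matrix n m F}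
    (hPQ : P * Q = 1) (U : Matrix m m F) : Qᵀ * (Pᵀ * U * P) * Q = U := by
  have hQP : Qᵀ * Pᵀ = 1 := by rw [← transpose_mul, hPQ, transpose_one]
  calc Qᵀ * (Pᵀ * U * P) * Q = (Qᵀ * Pᵀ) * U * (P * Q) := by simp only [Matrix.mul_assoc]
    _ = U := by rw [hPQ, hQP, Matrix.one_mul, Matrix.mul_one]

/-- If `P` has a right inverse and `U` is invertible, then `ᵗP ⬝ U ⬝ P` and `P` have the same
row space. -/
theorem range_vecMulLinear_transpose_mul_mul {P : Matrix m n F} {Q : Matrix n m F}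
    (hPQ : P * Q = 1) {U : Matrix m m F} (hU : IsUnit U) :
    LinearMap.range (Pᵀ * U * P).vecMulLinear = LinearMap.range P.vecMulLinear := by
  have hQP : Qᵀ * Pᵀ = 1 := by rw [← transpose_mul, hPQ, transpose_one]
  apply le_antisymm
  · rintro _ ⟨x, rfl⟩
    exact ⟨x ᵥ* (Pᵀ * U), by simp [vecMul_vecMul]⟩
  · rintro _ ⟨y, rfl⟩
    refine ⟨y ᵥ* (U⁻¹ * Qᵀ), ?_⟩
    have : U⁻¹ * Qᵀ * (Pᵀ * U * P) = P := by
      calc U⁻¹ * Qᵀ * (Pᵀ * U * P) = U⁻¹ * (Qᵀ * Pᵀ) * U * P := by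
            simp only [Matrix.mul_assoc]
        _ = P := by
          rw [hQP, Matrix.mul_one, nonsing_inv_mul _ ((isUnit_iff_isUnit_det U).1 hU),
            Matrix.one_mul]
    simp [vecMul_vecMul, this]

/-- A symmetric matrix with the same row space as a matrix `P` having right inverse `Q` is of the
form `ᵗP ⬝ U ⬝ P`. -/
theorem IsSymm.transpose_mul_mul_eq_of_range_vecMulLinear_le {W : Matrix n n F} (hW : W.IsSymm)
    {P : Matrix m n F} {Q : Matrix n m F} (hPQ : P * Q = 1)
    (h : LinearMap.range W.vecMulLinear ≤ LinearMap.range P.vecMulLinear) :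
    Pᵀ * (Qᵀ * W * Q) * P = W := by
  classical
  have hWQP : W * Q * P = W := by
    ext i j
    obtain ⟨y, hy⟩ := h ⟨Pi.single i 1, rfl⟩
    simp only [vecMulLinear_apply, single_one_vecMul] at hy
    have hrow : (W * Q * P).row i = W.row i := by
      rw [← single_one_vecMul i, Matrix.mul_assoc, ← vecMul_vecMul, single_one_vecMul, ← hy,
        vecMul_vecMul, ← Matrix.mul_assoc, hPQ, Matrix.one_mul]
    exact congrFun hrow j
  have hPQW : Pᵀ * Qᵀ * W = W := by
    have hT : (W * Q * P)ᵀ = Wᵀ := by rw [hWQP]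
    rwa [transpose_mul, transpose_mul, hW.eq, ← Matrix.mul_assoc] at hT
  calc Pᵀ * (Qᵀ * W * Q) * P = (Pᵀ * Qᵀ * W) * Q * P := by simp only [Matrix.mul_assoc]
    _ = W := by rw [hPQW, hWQP]

/-- If `ᵗP ⬝ U ⬝ P` has rank at least the size of `U`, then `U` is invertible. -/
theorem isUnit_of_card_le_rank_transpose_mul_mul {P : Matrix m n F} {U : Matrix m m F}
    (h : Fintype.card m ≤ (Pᵀ * U * P).rank) : IsUnit U := by
  have hU : U.rank = Fintype.card m :=
    le_antisymm U.rank_le_card_width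
      (h.trans ((rank_mul_le_left _ _).trans (rank_mul_le_right _ _)))
  rw [← mulVec_surjective_iff_isUnit]
  have : LinearMap.range U.mulVecLin = ⊤ :=
    Submodule.eq_top_of_finrank_eq (by simpa [Matrix.rank] using hU)
  exact LinearMap.range_eq_top.1 this

end Matrix

/-- Let `F_q` be a finite field, `ψ : (F_q, +) → ℂˣ` an additive character, `T` a symmetric
`r × r` matrix over `F_q`, and for every `m`-dimensional subspace `Δ` of `F_q^r` (`0 ≤ m ≤ r`)
fix `G_Δ ∈ GL_r(F_q)` whose first `m` rows span `Δ`, and set `T_Δ` equal to the upper-left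
`m × m` block of `G_Δ ⬝ T ⬝ ᵗG_Δ`.  Then `Σ_W ψ(tr(T·W))`, with `W` running over all symmetric
`r × r` matrices over `F_q`, equals `Σ_{m=0}^{r} Σ_Δ Σ_U ψ(tr(T_Δ·U))`, where `Δ` runs over all
`m`-dimensional subspaces of `F_q^r` and `U` runs over all invertible symmetric `m × m`
matrices over `F_q`.  (The sum over `m` and `Δ` of dimension `m` is organized as a single sum
over all subspaces `Δ`, with `m = dim Δ`.) -/
theorem sum_addChar_symm_eq_sum_over_subspaces
    {F : Type*} [Field F] [Fintype F] {r : ℕ}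
    (ψ : AddChar F ℂˣ)
    (T : Matrix (Fin r) (Fin r) F) (hT : T.IsSymm)
    (G : Submodule F (Fin r → F) → Matrix (Fin r) (Fin r) F)
    (hGunit : ∀ Δ : Submodule F (Fin r → F), IsUnit (G Δ))
    (hGspan : ∀ Δ : Submodule F (Fin r → F),
      Submodule.span F (Set.range fun i : Fin (Module.finrank F ↥Δ) =>
          G Δ (Fin.castLE ((Submodule.finrank_le Δ).trans_eq (Module.finrank_fin_fun F)) i))
        = Δ)
    [Fintype (Submodule F (Fin r → F))]
    [DecidablePred (Matrix.IsSymm : Matrix (Fin r) (Fin r) F → Prop)]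
    [∀ k : ℕ, DecidablePred fun U : Matrix (Fin k) (Fin k) F => U.IsSymm ∧ IsUnit U] :
    ∑ W : {W : Matrix (Fin r) (Fin r) F // W.IsSymm},
        ((ψ (Matrix.trace (T * (W : Matrix (Fin r) (Fin r) F))) : ℂˣ) : ℂ)
      = ∑ Δ : Submodule F (Fin r → F),
          ∑ U : {U : Matrix (Fin (Module.finrank F ↥Δ)) (Fin (Module.finrank F ↥Δ)) F //
              U.IsSymm ∧ IsUnit U},
            ((ψ (Matrix.trace
                (upperLeftBlock T (G Δ)
                    ((Submodule.finrank_le Δ).trans_eq (Module.finrank_fin_fun F))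
                  * (U : Matrix (Fin (Module.finrank F ↥Δ)) (Fin (Module.finrank F ↥Δ)) F)))
              : ℂˣ) : ℂ) := by
  classical
  have hle : ∀ Δ : Submodule F (Fin r → F), Module.finrank F Δ ≤ r := fun Δ =>
    (Submodule.finrank_le Δ).trans_eq (Module.finrank_fin_fun F)
  let P : ∀ Δ : Submodule F (Fin r → F), Matrix (Fin (Module.finrank F Δ)) (Fin r) F :=
    fun Δ => (G Δ).submatrix (Fin.castLE (hle Δ)) id
  let Q : ∀ Δ : Submodule F (Fin r → F), Matrix (Fin r) (Fin (Module.finrank F Δ)) F :=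
    fun Δ => (G Δ)⁻¹.submatrix id (Fin.castLE (hle Δ))
  have hPQ : ∀ Δ, P Δ * Q Δ = 1 := fun Δ => by
    rw [← submatrix_mul _ _ _ _ _ Function.bijective_id,
      mul_nonsing_inv _ ((isUnit_iff_isUnit_det _).1 (hGunit Δ)),
      submatrix_one _ (Fin.castLE_injective (hle Δ))]
  have hPrange : ∀ Δ, LinearMap.range (P Δ).vecMulLinear = Δ := fun Δ =>
    (range_vecMulLinear (P Δ)).trans (hGspan Δ)
  have hblock : ∀ Δ, upperLeftBlock T (G Δ) (hle Δ) = P Δ * T * (P Δ)ᵀ := fun _ => rfl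
  rw [← Fintype.sum_sigma']
  symm
  refine Fintype.sum_bijective
    (fun x => ⟨(P x.1)ᵀ * x.2.1 * P x.1, by
      simp [IsSymm, transpose_mul, x.2.2.1.eq, Matrix.mul_assoc]⟩) ⟨?_, ?_⟩ _ _ ?_
  · rintro ⟨Δ₁, U₁, hU₁⟩ ⟨Δ₂, U₂, hU₂⟩ h
    have h' : (P Δ₁)ᵀ * U₁ * P Δ₁ = (P Δ₂)ᵀ * U₂ * P Δ₂ := congrArg Subtype.val h
    obtain rfl : Δ₁ = Δ₂ := by
      rw [← hPrange Δ₁, ← hPrange Δ₂, ← range_vecMulLinear_transpose_mul_mul (hPQ Δ₁) hU₁.2,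
        ← range_vecMulLinear_transpose_mul_mul (hPQ Δ₂) hU₂.2, h']
    obtain rfl : U₁ = U₂ := by
      rw [← transpose_mul_mul_transpose_mul_mul_cancel (hPQ Δ₁) U₁, h',
        transpose_mul_mul_transpose_mul_mul_cancel (hPQ Δ₁)]
    rfl
  · rintro ⟨W, hW⟩
    let Δ := LinearMap.range W.vecMulLinear
    have hWΔ : (P Δ)ᵀ * ((Q Δ)ᵀ * W * Q Δ) * P Δ = W :=
      hW.transpose_mul_mul_eq_of_range_vecMulLinear_le (hPQ Δ) (hPrange Δ).ge
    have hrank : Module.finrank F Δ = W.rank := by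
      rw [W.rank_eq_finrank_span_row, ← range_vecMulLinear]
    refine ⟨⟨Δ, (Q Δ)ᵀ * W * Q Δ, ?_, ?_⟩, Subtype.ext hWΔ⟩
    · simp [IsSymm, transpose_mul, hW.eq, Matrix.mul_assoc]
    · refine isUnit_of_card_le_rank_transpose_mul_mul (P := P Δ) ?_
      rw [hWΔ, Fintype.card_fin, hrank]
  · rintro ⟨Δ, U, hU⟩
    have htrace : (P Δ * T * (P Δ)ᵀ * U).trace = (T * ((P Δ)ᵀ * U * P Δ)).trace := by
      rw [Matrix.mul_assoc, Matrix.mul_assoc, trace_mul_comm]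
      simp only [Matrix.mul_assoc]
    simp only [hblock, htrace]
end

section
/- Let F be a field, let A be a j×r matrix over F of rank r, and let B be a j×r matrix over F such that B·ᵗA is a symmetric j×j matrix. Then there exists a symmetric r×r matrix Y over F with A·Y = B. -/
open Matrix

/-- A matrix of full column rank over a field has a left inverse. -/
theorem Matrix.exists_left_inverse_of_rank_eq_card {F m n : Type*} [Field F] [Fintype m]
    [Fintype n] [DecidableEq n] (A : Matrix m n F) (hA : A.rank = Fintype.card n) :
    ∃ C : Matrix n m F, C * A = 1 := by
  rw [← vecMul_surjective_iff_exists_left_inverse]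
  have hrange : LinearMap.range Aᵀ.mulVecLin = ⊤ := by
    apply Submodule.eq_top_of_finrank_eq
    rw [Module.finrank_fintype_fun_eq_card, ← hA, ← rank_transpose A, Matrix.rank]
  intro v
  obtain ⟨w, hw⟩ := LinearMap.range_eq_top.mp hrange v
  exact ⟨w, by rw [← hw, mulVecLin_apply, mulVec_transpose]⟩

/-- Let `F` be a field, `A` a `j × r` matrix over `F` of rank `r` (full column rank), and `B` a
`j × r` matrix over `F` such that `B ⬝ ᵗA` is symmetric.  Then there exists a symmetric `r × r`
matrix `Y` over `F` with `A ⬝ Y = B`. -/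
theorem exists_symm_solution_of_full_column_rank
    {F : Type*} [Field F] {j r : ℕ}
    (A B : Matrix (Fin j) (Fin r) F)
    (hA : A.rank = r)
    (hsymm : (B * Aᵀ).IsSymm) :
    ∃ Y : Matrix (Fin r) (Fin r) F, Y.IsSymm ∧ A * Y = B := by
  obtain ⟨C, hC⟩ := A.exists_left_inverse_of_rank_eq_card (by rw [hA, Fintype.card_fin])
  have hAB : A * Bᵀ = B * Aᵀ := by
    simpa only [transpose_mul, transpose_transpose] using hsymm.eq
  have hsolve : A * (Bᵀ * Cᵀ) = B := by
    rw [← Matrix.mul_assoc, hAB, Matrix.mul_assoc, ← transpose_mul, hC, transpose_one,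
      Matrix.mul_one]
  refine ⟨Bᵀ * Cᵀ, ?_, hsolve⟩
  calc (Bᵀ * Cᵀ)ᵀ = C * B := by rw [transpose_mul, transpose_transpose, transpose_transpose]
    _ = C * (A * (Bᵀ * Cᵀ)) := by rw [hsolve]
    _ = Bᵀ * Cᵀ := by rw [← Matrix.mul_assoc, hC, Matrix.one_mul]
end

section
/- Let K be a number field with ring of integers O, and let 𝔄 and 𝔅 be nonzero fractional ideals of O. Then there exist elements a ∈ 𝔄, b ∈ 𝔅, c ∈ 𝔅⁻¹, d ∈ 𝔄⁻¹ with a·d − b·c = 1; equivalently, there is a 2×2 matrix (a b; c d) of determinant 1 whose (1,1)-entry lies in 𝔄, (1,2)-entry in 𝔅, (2,1)-entry in 𝔅⁻¹, and (2,2)-entry in 𝔄⁻¹. -/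
open NumberField
open scoped nonZeroDivisors

/-- Let `K` be a number field with ring of integers `O`, and let `𝔄` and `𝔅` be nonzero
fractional ideals of `O`.  Then there exist `a ∈ 𝔄`, `b ∈ 𝔅`, `c ∈ 𝔅⁻¹`, `d ∈ 𝔄⁻¹` with
`a·d − b·c = 1`; i.e. there is a `2 × 2` determinant-one matrix `(a b; c d)` with entries in
`(𝔄 𝔅; 𝔅⁻¹ 𝔄⁻¹)`. -/
theorem exists_det_one_matrix_in_fractional_ideals
    (K : Type*) [Field K] [NumberField K]
    (𝔄 𝔅 : FractionalIdeal (𝓞 K)⁰ K) (h𝔄 : 𝔄 ≠ 0) (h𝔅 : 𝔅 ≠ 0) :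
    ∃ a ∈ 𝔄, ∃ b ∈ 𝔅, ∃ c ∈ 𝔅⁻¹, ∃ d ∈ 𝔄⁻¹, a * d - b * c = 1 := by
  obtain ⟨r, hr, hr𝔄⟩ := FractionalIdeal.exists_ne_zero_mem_isInteger h𝔄
  set a : K := algebraMap (𝓞 K) K r
  have ha : a ≠ 0 := by simpa [a] using hr
  have h_le : FractionalIdeal.spanSingleton (𝓞 K)⁰ a * 𝔄⁻¹ ≤ 1 := by
    rw [← mul_inv_cancel₀ h𝔄]
    gcongr
    exact FractionalIdeal.spanSingleton_le_iff_mem.mpr hr𝔄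
  obtain ⟨b, hb⟩ := IsDedekindDomain.exists_add_spanSingleton_mul_eq h_le
    (mul_ne_zero (FractionalIdeal.spanSingleton_ne_zero_iff.mpr ha) (inv_ne_zero h𝔄))
    (inv_ne_zero h𝔅)
  have hb𝔅 : b ∈ 𝔅 := by
    have h : FractionalIdeal.spanSingleton (𝓞 K)⁰ b * 𝔅⁻¹ ≤ 1 := hb ▸ le_add_self
    rw [← FractionalIdeal.spanSingleton_le_iff_mem]
    calc FractionalIdeal.spanSingleton (𝓞 K)⁰ b
        = FractionalIdeal.spanSingleton (𝓞 K)⁰ b * 𝔅⁻¹ * 𝔅 := by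
          rw [mul_assoc, inv_mul_cancel₀ h𝔅, mul_one]
      _ ≤ 1 * 𝔅 := by gcongr
      _ = 𝔅 := one_mul 𝔅
  have h_one : (1 : K) ∈ FractionalIdeal.spanSingleton (𝓞 K)⁰ a * 𝔄⁻¹ +
      FractionalIdeal.spanSingleton (𝓞 K)⁰ b * 𝔅⁻¹ := hb ▸ FractionalIdeal.one_mem_one _
  obtain ⟨u, hu, v, hv, huv⟩ := (FractionalIdeal.mem_add _ _ _).mp h_one
  obtain ⟨d, hd, rfl⟩ := FractionalIdeal.mem_singleton_mul.mp hu
  obtain ⟨c, hc, rfl⟩ := FractionalIdeal.mem_singleton_mul.mp hv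
  exact ⟨a, hr𝔄, b, hb𝔅, -c, (𝔅⁻¹ : FractionalIdeal (𝓞 K)⁰ K).coeToSubmodule.neg_mem hc, d, hd, by rw [← huv]; ring⟩
end
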